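/- Let M be a strongly bounded Puiseux monoid. If M is atomic, then every generating set of M contains a strongly bounded subset that still generates M. -/

import Mathlib

/-- A Puiseux monoid is an additive submonoid of the nonnegative rationals. -/
def IsPuiseux (M : AddSubmonoid ℚ) : Prop := ∀ x ∈ M, 0 ≤ x

/-- `a` is an atom of the Puiseux monoid `M`. -/
def PMAtom (M : AddSubmonoid ℚ) (a : ℚ) : Prop :=
  a ∈ M ∧ a ≠ 0 ∧ ∀ x ∈ M, ∀ y ∈ M, a = x + y → x = 0 ∨ y = 0

/-- `M` is atomic: every element of `M` is a finite sum of atoms of `M`. -/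
def PMAtomic (M : AddSubmonoid ℚ) : Prop :=
  ∀ m ∈ M, ∃ l : Multiset ℚ, (∀ a ∈ l, PMAtom M a) ∧ l.sum = m

/-- A set of rationals is strongly bounded if its numerator set is bounded. -/
def StronglyBoundedSet (S : Set ℚ) : Prop := ∃ B : ℤ, ∀ s ∈ S, s.num ≤ B

/-- `M` is strongly bounded: it is generated by a strongly bounded set of rationals. -/
def StronglyBounded (M : AddSubmonoid ℚ) : Prop :=
  ∃ S : Set ℚ, AddSubmonoid.closure S = M ∧ StronglyBoundedSet S

/-- Every generating set of a submonoid of `ℚ` contains all of its atoms. -/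
theorem PMAtom.mem_of_closure_eq {M : AddSubmonoid ℚ} {R : Set ℚ}
    (hR : AddSubmonoid.closure R = M) {a : ℚ} (ha : PMAtom M a) : a ∈ R := by
  subst hR
  have key : ∀ x ∈ AddSubmonoid.closure R, PMAtom (AddSubmonoid.closure R) x → x ∈ R := by
    intro x hx
    induction hx using AddSubmonoid.closure_induction with
    | mem x hx => exact fun _ => hx
    | zero => exact fun h => absurd rfl h.2.1
    | add x y hx hy ihx ihy =>
      intro h
      rcases h.2.2 x hx y hy rfl with rfl | rfl
      · simp only [zero_add] at h ⊢
        exact ihy h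
      · simp only [add_zero] at h ⊢
        exact ihx h
  exact key a ha.1 ha

/-- An atomic Puiseux monoid is generated by its atoms. -/
theorem PMAtomic.closure_setOf_atom {M : AddSubmonoid ℚ} (hat : PMAtomic M) :
    AddSubmonoid.closure {a | PMAtom M a} = M := by
  refine le_antisymm (AddSubmonoid.closure_le.2 fun a ha => ha.1) fun m hm => ?_
  obtain ⟨l, hl, rfl⟩ := hat m hm
  exact AddSubmonoid.multiset_sum_mem _ _ fun a ha => AddSubmonoid.subset_closure (hl a ha)

/-- If `M` is a strongly bounded atomic Puiseux monoid, then every generating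
set of `M` contains a strongly bounded subset that still generates `M`. -/
theorem strongly_bounded_atomic_generating_sets (M : AddSubmonoid ℚ) (hM : IsPuiseux M)
    (hsb : StronglyBounded M) (hat : PMAtomic M) :
    ∀ R : Set ℚ, AddSubmonoid.closure R = M →
      ∃ S ⊆ R, StronglyBoundedSet S ∧ AddSubmonoid.closure S = M := by
  intro R hR
  obtain ⟨T, hT, B, hB⟩ := hsb
  exact ⟨{a | PMAtom M a}, fun a ha => PMAtom.mem_of_closure_eq hR ha,
    ⟨B, fun a ha => hB a (PMAtom.mem_of_closure_eq hT ha)⟩, hat.closure_setOf_atom⟩
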